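/- arXiv:math/0201296 — 2 statements merged into one kernel-verified Lean document; each statement's English description precedes it below -/
import Mathlib

section
/- Let F : ℝⁿ → ℝⁿ be a map of class C^l for some integer l ≥ 1, and for k ∈ {0, 1, …, n−1} let A_k = {x ∈ ℝⁿ : rank of the derivative dF(x) is at most k}. Then the Hausdorff measure ℋ^{k + (n−k)/l} of the image F(A_k) is zero. -/
open MeasureTheory

namespace FedererSard

open Topology Filter Set

/-- `ℝⁿ` with the sup norm. -/
abbrev V (n : ℕ) := Fin n → ℝ

/-- Inverse function theorem, packaged. -/
theorem ift {E E' : Type*} [NormedAddCommGroup E] [NormedSpace ℝ E] [FiniteDimensional ℝ E]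
    [NormedAddCommGroup E'] [NormedSpace ℝ E'] [FiniteDimensional ℝ E']
    (hd : Module.finrank ℝ E = Module.finrank ℝ E') {l : ℕ} (hl : 1 ≤ l) {Φ : E → E'} {a : E}
    (hΦ : ContDiffAt ℝ l Φ a) (hinj : ∀ v, fderiv ℝ Φ a v = 0 → v = 0) :
    ∃ Ψ : E' → E, ∃ U ∈ 𝓝 a, ∀ w ∈ U, Ψ (Φ w) = w ∧ ContDiffAt ℝ l Ψ (Φ w) ∧
      ∀ᶠ c in 𝓝 (Φ w), Φ (Ψ c) = c := by
  have hl0 : (l : WithTop ℕ∞) ≠ 0 := by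
    exact_mod_cast (by omega : l ≠ 0)
  have hinj' : Function.Injective (fderiv ℝ Φ a : E →ₗ[ℝ] E') := by
    rw [injective_iff_map_eq_zero]
    exact hinj
  let e : E ≃L[ℝ] E' :=
    (LinearMap.linearEquivOfInjective (fderiv ℝ Φ a : E →ₗ[ℝ] E') hinj' hd).toContinuousLinearEquiv
  have he : (e : E →L[ℝ] E') = fderiv ℝ Φ a := by
    ext v
    rfl
  have : CompleteSpace E := FiniteDimensional.complete ℝ E
  have hf' : HasFDerivAt Φ (e : E →L[ℝ] E') a := by
    rw [he]
    exact (hΦ.differentiableAt hl0).hasFDerivAt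
  have hs := hΦ.hasStrictFDerivAt' hf' hl0
  refine ⟨hΦ.localInverse hf' hl0, _, ?_, fun w hw => hw⟩
  have h1 := hs.eventually_left_inverse
  have h2 := (hs.eventually_right_inverse).eventually_nhds
  have h3 := (hΦ.to_localInverse hf' hl0).eventually (by simp)
  have hc : Tendsto Φ (𝓝 a) (𝓝 (Φ a)) := hΦ.continuousAt
  filter_upwards [h1, hc.eventually h2, hc.eventually h3] with w a1 a2 a3
  exact ⟨a1, a3, a2⟩

/-- Locally uniform little-o of order `m` along the fibres. -/
def LO {k d : ℕ} (m : ℕ) (B : Set (V k × V d)) (b : V k × V d)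
    (φ : V k × V d → V k × V d → ℝ) : Prop :=
  ∃ N ∈ 𝓝 b, ∀ ε > 0, ∃ δ > 0, ∀ u ∈ B ∩ N, ∀ v ∈ N, u.1 = v.1 → ‖u.2 - v.2‖ ≤ δ →
    |φ u v| ≤ ε * ‖u.2 - v.2‖ ^ m

theorem LO.mono {k d m : ℕ} {B : Set (V k × V d)} {b : V k × V d}
    {φ φ' : V k × V d → V k × V d → ℝ} (h : LO m B b φ) (h' : ∀ u ∈ B, ∀ v, |φ' u v| ≤ |φ u v|) :
    LO m B b φ' := by
  obtain ⟨N, hN, H⟩ := h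
  refine ⟨N, hN, fun ε hε => ?_⟩
  obtain ⟨δ, hδ, H⟩ := H ε hε
  exact ⟨δ, hδ, fun u hu v hv e1 e2 => (h' u hu.1 v).trans (H u hu v hv e1 e2)⟩

theorem LO.sum {k d m : ℕ} {B : Set (V k × V d)} {b : V k × V d} {ι : Type*} (s : Finset ι)
    {φ : ι → V k × V d → V k × V d → ℝ} (h : ∀ i ∈ s, LO m B b (φ i)) :
    LO m B b (fun u v => ∑ i ∈ s, |φ i u v|) := by
  classical
  induction s using Finset.induction_on with
  | empty =>
    refine ⟨univ, univ_mem, fun ε hε => ⟨1, one_pos, fun u _ v _ _ _ => ?_⟩⟩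
    simp
    positivity
  | insert i s hi ih =>
    obtain ⟨N, hN, H⟩ := h i (by simp)
    obtain ⟨N', hN', H'⟩ := ih (fun j hj => h j (by simp [hj]))
    refine ⟨N ∩ N', inter_mem hN hN', fun ε hε => ?_⟩
    obtain ⟨δ, hδ, H⟩ := H (ε/2) (by positivity)
    obtain ⟨δ', hδ', H'⟩ := H' (ε/2) (by positivity)
    refine ⟨min δ δ', lt_min hδ hδ', fun u hu v hv e1 e2 => ?_⟩
    have a1 := H u ⟨hu.1, hu.2.1⟩ v hv.1 e1 (e2.trans (min_le_left _ _))
    have a2 := H' u ⟨hu.1, hu.2.2⟩ v hv.2 e1 (e2.trans (min_le_right _ _))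
    simp only [Finset.sum_insert hi]
    refine (abs_add_le _ _).trans ?_
    rw [abs_abs]
    linarith

theorem apply_inr_le {k p : ℕ} (L : (V k × V p) →L[ℝ] ℝ) (w : V p) :
    |L (0, w)| ≤ (∑ i, |L (0, Pi.single i 1)|) * ‖w‖ := by
  have h1 : L (0, w) = ∑ i, w i * L (0, Pi.single i 1) := by
    have := LinearMap.pi_apply_eq_sum_univ
      ((L : (V k × V p) →ₗ[ℝ] ℝ) ∘ₗ LinearMap.inr ℝ (V k) (V p)) w
    simp only [LinearMap.comp_apply, LinearMap.inr_apply, ContinuousLinearMap.coe_coe,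
      smul_eq_mul] at this
    rw [this]
    refine Finset.sum_congr rfl fun i _ => ?_
    congr 3
    ext j
    simp [Pi.single_apply, eq_comm]
  rw [h1, Finset.sum_mul]
  refine (Finset.abs_sum_le_sum_abs _ _).trans (Finset.sum_le_sum fun i _ => ?_)
  rw [abs_mul, mul_comm]
  gcongr
  exact norm_le_pi_norm w i

/-- Mean value step. -/
theorem LO.mean_value {k d p m : ℕ} {B : Set (V k × V d)} {b : V k × V d}
    {ψ : V k × V d → V p} (hψ : ContDiffAt ℝ 1 ψ b) {f : V k × V p → ℝ}
    (hf : ContDiffAt ℝ 1 f (b.1, ψ b))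
    (h : ∀ i, LO m B b (fun _ v => fderiv ℝ f (v.1, ψ v) (0, Pi.single i 1))) :
    LO (m + 1) B b (fun u v => f (v.1, ψ v) - f (u.1, ψ u)) := by
  obtain ⟨N, hN, H⟩ := LO.sum Finset.univ (fun i _ => h i)
  set K : ℝ := ‖fderiv ℝ ψ b‖ + 1 with hK
  have hKpos : 0 < K := by positivity
  have e1 : ∀ᶠ v in 𝓝 b, DifferentiableAt ℝ ψ v := by
    filter_upwards [hψ.eventually (by simp)] with v hv using hv.differentiableAt (by simp)
  have hcont : Tendsto (fun v : V k × V d => (v.1, ψ v)) (𝓝 b) (𝓝 (b.1, ψ b)) :=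
    continuousAt_fst.prodMk hψ.continuousAt
  have e2 : ∀ᶠ v in 𝓝 b, DifferentiableAt ℝ f (v.1, ψ v) := by
    filter_upwards [hcont.eventually (hf.eventually (by simp))] with v hv
      using hv.differentiableAt (by simp)
  have e3 : ∀ᶠ v in 𝓝 b, ‖fderiv ℝ ψ v‖ < K := by
    have : ContDiffAt ℝ 0 (fderiv ℝ ψ) b := hψ.fderiv_right (by simp)
    exact this.continuousAt.norm.eventually_lt_const (by simp [hK])
  obtain ⟨r, hr, hball⟩ := Metric.eventually_nhds_iff_ball.1
    (e1.and (e2.and (e3.and (eventually_mem_set.2 hN))))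
  refine ⟨Metric.ball b r, Metric.ball_mem_nhds _ hr, fun ε hε => ?_⟩
  obtain ⟨δ, hδ, H⟩ := H (ε / K) (by positivity)
  refine ⟨δ, hδ, fun u hu v hv huv hle => ?_⟩
  let γ : ℝ → V k × V d := fun t => u + t • (v - u)
  have hγ : ∀ t, HasDerivAt γ (v - u) t := fun t => by
    have := ((hasDerivAt_id t).smul_const (v - u)).const_add u
    rwa [one_smul] at this
  have hγmem : ∀ t ∈ Icc (0:ℝ) 1, γ t ∈ Metric.ball b r := fun t ht =>
    (convex_ball b r).add_smul_sub_mem hu.2 hv ht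
  have hγ1 : ∀ t, (γ t).1 = u.1 := fun t => by simp [γ, huv]
  have hγ2 : ∀ t, (γ t).2 = u.2 + t • (v.2 - u.2) := fun t => by simp [γ]
  let F' : ℝ → ℝ := fun t =>
    fderiv ℝ f ((γ t).1, ψ (γ t)) (0, fderiv ℝ ψ (γ t) (v - u))
  have hder : ∀ t ∈ Icc (0:ℝ) 1,
      HasDerivWithinAt (fun t => f ((γ t).1, ψ (γ t))) (F' t) (Icc 0 1) t := by
    intro t ht
    obtain ⟨d1, d2, -, -⟩ := hball _ (hγmem t ht)
    have a1 : HasDerivAt (fun t => ψ (γ t)) (fderiv ℝ ψ (γ t) (v - u)) t :=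
      d1.hasFDerivAt.comp_hasDerivAt t (hγ t)
    have a2 : HasDerivAt (fun t => (γ t).1) 0 t := by
      simp only [hγ1]
      exact hasDerivAt_const _ _
    exact (d2.hasFDerivAt.comp_hasDerivAt t (a2.prodMk a1)).hasDerivWithinAt
  have hnorm : ‖v - u‖ = ‖u.2 - v.2‖ := by
    rw [Prod.norm_def]
    simp [huv, norm_sub_rev]
  have hbound : ∀ t ∈ Ico (0:ℝ) 1, ‖F' t‖ ≤ ε * ‖u.2 - v.2‖ ^ (m + 1) := by
    intro t ht
    have ht' : t ∈ Icc (0:ℝ) 1 := ⟨ht.1, ht.2.le⟩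
    obtain ⟨-, -, d3, d4⟩ := hball _ (hγmem t ht')
    have hd : ‖u.2 - (γ t).2‖ ≤ ‖u.2 - v.2‖ := by
      rw [hγ2]
      have : u.2 - (u.2 + t • (v.2 - u.2)) = t • (u.2 - v.2) := by
        rw [← sub_sub, sub_self, zero_sub, ← smul_neg, neg_sub]
      rw [this, norm_smul, Real.norm_of_nonneg ht.1]
      exact mul_le_of_le_one_left (norm_nonneg _) ht.2.le
    have hH := H u ⟨hu.1, (hball u hu.2).2.2.2⟩ (γ t) d4 (hγ1 t).symm (hd.trans hle)
    rw [abs_of_nonneg (Finset.sum_nonneg fun _ _ => abs_nonneg _)] at hH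
    calc ‖F' t‖ ≤ (∑ i, |fderiv ℝ f ((γ t).1, ψ (γ t)) (0, Pi.single i 1)|)
          * ‖fderiv ℝ ψ (γ t) (v - u)‖ := apply_inr_le _ _
      _ ≤ (ε / K * ‖u.2 - v.2‖ ^ m) * (K * ‖u.2 - v.2‖) := by
        gcongr
        · refine hH.trans ?_
          gcongr
        · refine ((fderiv ℝ ψ (γ t)).le_opNorm _).trans ?_
          rw [hnorm]
          gcongr
      _ = ε * ‖u.2 - v.2‖ ^ (m + 1) := by field_simp; ring
  have := norm_image_sub_le_of_norm_deriv_le_segment_01' hder hbound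
  simpa [γ] using this

/-- `f` is `C^l` at the points of `A` and vanishes on `A`. -/
def Van {k p : ℕ} (l : ℕ) (A : Set (V k × V p)) (f : V k × V p → ℝ) : Prop :=
  ∀ a ∈ A, ContDiffAt ℝ l f a ∧ f a = 0

/-- A piece of `A`, parametrised so that all functions of `Van l A` are small. -/
def Piece {k p : ℕ} (l : ℕ) (A S : Set (V k × V p)) : Prop :=
  ∃ d ≤ p, ∃ B : Set (V k × V d), ∃ ψ : V k × V d → V p,
    (∀ b ∈ B, ContDiffAt ℝ 1 ψ b ∧ (b.1, ψ b) ∈ A) ∧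
    (∀ f, Van l A f → ∀ b ∈ B, LO l B b (fun _ v => f (v.1, ψ v))) ∧
    S = (fun b => (b.1, ψ b)) '' B

theorem Van.fderiv {k p l : ℕ} {A A₀ : Set (V k × V p)} {f : V k × V p → ℝ}
    (hf : Van (l + 1) A f) (hA : A₀ ⊆ A) {w : V k × V p} (h : ∀ a ∈ A₀, fderiv ℝ f a w = 0) :
    Van l A₀ (fun a => fderiv ℝ f a w) := by
  intro a ha
  refine ⟨?_, h a ha⟩
  have := (hf a (hA ha)).1.fderiv_right (m := l) (by simp)
  exact this.clm_apply contDiffAt_const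

theorem base {k p : ℕ} (A : Set (V k × V p)) (μ : OuterMeasure (V k × V p))
    (hμ : ∀ S, Piece 0 A S → μ S = 0) : μ A = 0 := by
  apply hμ
  refine ⟨p, le_rfl, A, Prod.snd, fun b hb => ⟨contDiffAt_snd, hb⟩, ?_, by simp⟩
  intro f hf b hb
  have h1 := (hf b hb).1.eventually (by simp)
  obtain ⟨r, hr, hball⟩ := Metric.nhds_basis_closedBall.eventually_iff.1 h1
  have hcont : ContinuousOn f (Metric.closedBall b r) := fun x hx =>
    (hball hx).continuousAt.continuousWithinAt
  have huc := (isCompact_closedBall b r).uniformContinuousOn_of_continuous hcont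
  refine ⟨_, Metric.closedBall_mem_nhds b hr, fun ε hε => ?_⟩
  obtain ⟨δ, hδ, H⟩ := Metric.uniformContinuousOn_iff.1 huc ε hε
  refine ⟨δ / 2, by positivity, fun u hu v hv huv hle => ?_⟩
  have := H u hu.2 v hv (by
    rw [Prod.dist_eq, dist_eq_norm u.2, huv, dist_self]
    exact max_lt hδ (by linarith))
  rw [Real.dist_eq, (hf u hu.1).2, zero_sub, abs_neg] at this
  simpa using this.le

theorem step {k l : ℕ}
    (ihl : ∀ (p : ℕ) (A : Set (V k × V p)) (μ : OuterMeasure (V k × V p)),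
      (∀ S, Piece l A S → μ S = 0) → μ A = 0) (p : ℕ)
    (ihp : ∀ p', p' + 1 = p → ∀ (A : Set (V k × V p')) (μ : OuterMeasure (V k × V p')),
      (∀ S, Piece (l + 1) A S → μ S = 0) → μ A = 0)
    (A : Set (V k × V p)) (μ : OuterMeasure (V k × V p))
    (hμ : ∀ S, Piece (l + 1) A S → μ S = 0) : μ A = 0 := by
  let A' : Set (V k × V p) :=
    {a ∈ A | ∃ g, Van (l + 1) A g ∧ ∃ i, fderiv ℝ g a (0, Pi.single i 1) ≠ 0}
  have hsplit : A = A' ∪ (A \ A') := by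
    rw [union_sdiff_cancel]
    exact fun a ha => ha.1
  have h0 : μ (A \ A') = 0 := by
    apply ihl
    rintro S ⟨d, hd, B, ψ, hB, hLO, hS⟩
    apply hμ
    refine ⟨d, hd, B, ψ, fun b hb => ⟨(hB b hb).1, (hB b hb).2.1⟩, ?_, hS⟩
    intro f hf b hb
    have hvan : ∀ i, Van l (A \ A') (fun a => fderiv ℝ f a (0, Pi.single i 1)) := by
      intro i
      refine hf.fderiv sdiff_subset fun a ha => ?_
      by_contra hne
      exact ha.2 ⟨ha.1, f, hf, i, hne⟩
    have hb2 := (hf _ (hB b hb).2.1).1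
    have := LO.mean_value (hB b hb).1 (hb2.of_le (by simp)) (fun i => hLO _ (hvan i) b hb)
    refine this.mono fun u hu v => ?_
    rw [(hf _ (hB u hu).2.1).2, sub_zero]
  have h1 : μ A' = 0 := by
    apply measure_null_of_locally_null
    rintro a ⟨haA, g, hg, i, hi⟩
    obtain ⟨p', rfl⟩ : ∃ p', p = p' + 1 := ⟨p - 1, by have := i.2; omega⟩
    let π : V (p' + 1) →L[ℝ] V p' :=
      ContinuousLinearMap.pi fun j => ContinuousLinearMap.proj (i.succAbove j)
    let Λ : (V k × V (p' + 1)) →L[ℝ] (V k × V p') :=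
      (ContinuousLinearMap.fst ℝ _ _).prod (π ∘L ContinuousLinearMap.snd ℝ _ _)
    let Φ : V k × V (p' + 1) → (V k × V p') × ℝ := fun w => (Λ w, g w)
    have hΦ : ContDiffAt ℝ (l + 1 : ℕ) Φ a := Λ.contDiff.contDiffAt.prodMk (hg a haA).1
    have hgd : DifferentiableAt ℝ g a := (hg a haA).1.differentiableAt (by simp)
    have hΦ' : fderiv ℝ Φ a = Λ.prod (fderiv ℝ g a) :=
      (Λ.hasFDerivAt.prodMk hgd.hasFDerivAt).fderiv
    have hinj : ∀ v, fderiv ℝ Φ a v = 0 → v = 0 := by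
      rintro ⟨x, y⟩ hv
      rw [hΦ'] at hv
      simp only [ContinuousLinearMap.prod_apply, Prod.mk_eq_zero, Λ,
        ContinuousLinearMap.coe_fst', ContinuousLinearMap.comp_apply,
        ContinuousLinearMap.coe_snd'] at hv
      obtain ⟨⟨rfl, h2⟩, h3⟩ := hv
      have hy : y = y i • (Pi.single i 1 : V (p' + 1)) := by
        ext j
        by_cases hj : j = i
        · subst hj; simp
        · obtain ⟨j', rfl⟩ := Fin.exists_succAbove_eq hj
          have := congrFun h2 j'
          simpa [π, hj] using this
      have h4 : ((0 : V k), y) = y i • ((0 : V k), (Pi.single i 1 : V (p' + 1))) := by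
        rw [Prod.smul_mk, smul_zero, ← hy]
      rw [h4, map_smul, smul_eq_mul] at h3
      have : y i = 0 := (mul_eq_zero.1 h3).resolve_right hi
      rw [h4, this, zero_smul]
    obtain ⟨Ψ, U, hU, hΨ⟩ := ift (by simp; ring) (by omega) hΦ hinj
    let ψ₀ : V k × V p' → V (p' + 1) := fun c => (Ψ (c, 0)).2
    let B₀ : Set (V k × V p') := {c | ∃ w ∈ A ∩ U, Φ w = (c, 0)}
    have key : ∀ c ∈ B₀, (c.1, ψ₀ c) ∈ A ∧ ContDiffAt ℝ (l + 1 : ℕ) ψ₀ c := by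
      rintro c ⟨w, ⟨hwA, hwU⟩, hw⟩
      obtain ⟨e1, e2, -⟩ := hΨ w hwU
      rw [hw] at e1 e2
      have hc : c.1 = w.1 := by
        have := congrArg (fun z => z.1.1) hw
        exact this.symm
      constructor
      · simp only [ψ₀, e1, hc]
        exact hwA
      · have : ContDiffAt ℝ (l + 1 : ℕ) (fun c : V k × V p' => Ψ (c, 0)) c :=
          ContDiffAt.comp c e2 (contDiffAt_id.prodMk contDiffAt_const)
        exact contDiffAt_snd.comp c this
    have himg : A' ∩ U ⊆ (fun c => (c.1, ψ₀ c)) '' B₀ := by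
      rintro w ⟨hwA', hwU⟩
      have hw : Φ w = (Λ w, 0) := by simp only [Φ, (hg w hwA'.1).2]
      refine ⟨Λ w, ⟨w, ⟨hwA'.1, hwU⟩, hw⟩, ?_⟩
      obtain ⟨e1, -, -⟩ := hΨ w hwU
      rw [hw] at e1
      simp only [ψ₀, e1]
      rfl
    refine ⟨A' ∩ U, inter_mem_nhdsWithin _ hU, measure_mono_null himg ?_⟩
    rw [← OuterMeasure.comap_apply]
    apply ihp p' rfl
    rintro S ⟨d, hd, B, ψ, hB, hLO, rfl⟩
    rw [OuterMeasure.comap_apply]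
    apply hμ
    refine ⟨d, by omega, B, fun b => ψ₀ (b.1, ψ b), ?_, ?_, ?_⟩
    · intro b hb
      obtain ⟨k1, k2⟩ := key _ (hB b hb).2
      refine ⟨?_, k1⟩
      have k3 : ContDiffAt ℝ 1 ψ₀ (b.1, ψ b) := k2.of_le (by simp)
      exact ContDiffAt.comp (g := ψ₀) b k3 (contDiffAt_fst.prodMk (hB b hb).1)
    · intro f hf b hb
      refine hLO (fun c => f (c.1, ψ₀ c)) (fun c hc => ?_) b hb
      obtain ⟨k1, k2⟩ := key c hc
      exact ⟨ContDiffAt.comp c (hf _ k1).1 (contDiffAt_fst.prodMk k2), (hf _ k1).2⟩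
    · rw [image_image]
  rw [hsplit]
  exact measure_union_null h1 h0

theorem morse {k : ℕ} (l : ℕ) : ∀ (p : ℕ) (A : Set (V k × V p)) (μ : OuterMeasure (V k × V p)),
      (∀ S, Piece l A S → μ S = 0) → μ A = 0 := by
  induction l with
  | zero => exact fun p => base
  | succ l ihl =>
    intro p
    induction p with
    | zero => exact step ihl 0 (fun p' h => by omega)
    | succ p ihp =>
      refine step ihl (p + 1) (fun p' h => ?_)
      obtain rfl : p' = p := by omega
      exact ihp

theorem grid (k : ℕ) (c : V k) {r η : ℝ} (hr : 0 < r) (hη : 0 < η) (hη1 : η ≤ 1) :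
    ∃ M : ℕ, (M : ℝ) ≤ (2 * r + 1) / η ∧ ∃ t : (Fin k → Fin M) → Set (V k),
      Metric.closedBall c r ⊆ ⋃ i, t i ∧ ∀ i, ∀ x ∈ t i, ∀ y ∈ t i, ‖x - y‖ ≤ η := by
  refine ⟨⌊2 * r / η⌋₊ + 1, ?_, fun i => {x | ∀ j, c j - r + (i j : ℕ) * η ≤ x j ∧
    x j ≤ c j - r + ((i j : ℕ) + 1) * η}, ?_, ?_⟩
  · have h1 : (⌊2 * r / η⌋₊ : ℝ) ≤ 2 * r / η := Nat.floor_le (by positivity)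
    have h2 : 1 ≤ 1 / η := by rw [le_div_iff₀ hη]; linarith
    push_cast
    rw [add_div]
    linarith
  · intro x hx
    rw [mem_iUnion]
    have hx' : ∀ j, |x j - c j| ≤ r := fun j => by
      have := norm_le_pi_norm (x - c) j
      rw [Metric.mem_closedBall, dist_eq_norm] at hx
      exact this.trans hx
    have hpos : ∀ j, 0 ≤ (x j - c j + r) / η := fun j => by
      have := (abs_le.1 (hx' j)).1
      exact div_nonneg (by linarith) hη.le
    refine ⟨fun j => ⟨⌊(x j - c j + r) / η⌋₊, ?_⟩, fun j => ?_⟩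
    · rw [Nat.lt_succ_iff]
      apply Nat.floor_le_floor
      have := (abs_le.1 (hx' j)).2
      gcongr
      linarith
    · have h1 := Nat.floor_le (hpos j)
      have h2 := (Nat.lt_floor_add_one ((x j - c j + r) / η)).le
      rw [le_div_iff₀ hη] at h1
      rw [div_le_iff₀ hη] at h2
      constructor
      · simp only
        linarith
      · simp only
        linarith
  · intro i x hx y hy
    rw [pi_norm_le_iff_of_nonneg hη.le]
    intro j
    rw [Pi.sub_apply, Real.norm_eq_abs, abs_le]
    have h1 := hx j
    have h2 := hy j
    constructor <;> linarith [h1.1, h1.2, h2.1, h2.2]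

theorem count_bound {k d p l : ℕ} (hl : 1 ≤ l) (hd : d ≤ p) {R C ε δ M₁ M₂ : ℝ}
    (hR : 0 < R) (hC : 0 < C) (hε : 0 < ε) (hδ : 0 < δ) (hδ1 : δ ≤ 1)
    (hM₁0 : 0 ≤ M₁) (hM₂0 : 0 ≤ M₂)
    (hM₁ : M₁ ≤ R / (ε * δ ^ l)) (hM₂ : M₂ ≤ R / δ) :
    M₁ ^ k * M₂ ^ d * (C * (ε * δ ^ l)) ^ ((k : ℝ) + (p : ℝ) / l) ≤
      R ^ k * R ^ d * C ^ ((k : ℝ) + (p : ℝ) / l) * ε ^ ((p : ℝ) / l) := by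
  have hη : 0 < ε * δ ^ l := by positivity
  have hl0 : (l : ℝ) ≠ 0 := by exact_mod_cast (by omega : l ≠ 0)
  have e1 : (C * (ε * δ ^ l)) ^ ((k : ℝ) + (p : ℝ) / l) =
      C ^ ((k : ℝ) + (p : ℝ) / l) * ((ε * δ ^ l) ^ k * (ε ^ ((p : ℝ) / l) * δ ^ p)) := by
    rw [Real.mul_rpow hC.le hη.le, Real.rpow_add hη, Real.rpow_natCast,
      Real.mul_rpow hε.le (by positivity), ← Real.rpow_natCast δ l, ← Real.rpow_mul hδ.le,
      mul_div_cancel₀ _ hl0, Real.rpow_natCast δ p]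
  have e2 : δ ^ p ≤ δ ^ d := pow_le_pow_of_le_one hδ.le hδ1 hd
  rw [e1]
  calc _ ≤ (R / (ε * δ ^ l)) ^ k * (R / δ) ^ d * (C ^ ((k : ℝ) + (p : ℝ) / l) *
        ((ε * δ ^ l) ^ k * (ε ^ ((p : ℝ) / l) * δ ^ d))) := by gcongr
    _ = _ := by
      rw [div_pow, div_pow]
      have : (ε * δ ^ l) ^ k ≠ 0 := by positivity
      generalize (ε * δ ^ l) ^ k = q at *
      generalize ε ^ ((p : ℝ) / l) = q' at *
      field_simp

theorem box {k d p l n : ℕ} (hl : 1 ≤ l) (hd : d ≤ p) (hp : 1 ≤ p)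
    {h : V k × V d → EuclideanSpace ℝ (Fin n)}
    {B : Set (V k × V d)} {b : V k × V d} {K : NNReal} {N : Set (V k × V d)} (hN : N ∈ 𝓝 b)
    (hK : LipschitzOnWith K h N) (hLO : LO l B b (fun u v => ‖h v - h u‖)) :
    ∃ u ∈ 𝓝 b, μH[(k : ℝ) + (p : ℝ) / l] (h '' (B ∩ u)) = 0 := by
  obtain ⟨N', hN', H⟩ := hLO
  obtain ⟨r, hr, hball⟩ := Metric.nhds_basis_closedBall.mem_iff.1 (inter_mem hN hN')
  refine ⟨_, Metric.closedBall_mem_nhds b hr, ?_⟩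
  set ε : ℕ → ℝ := fun m => 1 / ((m : ℝ) + 1) with hεdef
  have hε : ∀ m, 0 < ε m := fun m => by positivity
  have hε1 : ∀ m, ε m ≤ 1 := fun m => by
    simp only [hεdef]
    rw [div_le_one (by positivity)]
    linarith [(Nat.cast_nonneg m : (0:ℝ) ≤ m)]
  have hεlim : Tendsto ε atTop (𝓝 0) := tendsto_one_div_add_atTop_nhds_zero_nat
  have H' : ∀ m, ∃ δ, 0 < δ ∧ δ ≤ 1 ∧ ∀ u ∈ B ∩ N', ∀ v ∈ N', u.1 = v.1 →
      ‖u.2 - v.2‖ ≤ δ → ‖h v - h u‖ ≤ ε m * ‖u.2 - v.2‖ ^ l := by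
    intro m
    obtain ⟨δ, hδ, H⟩ := H (ε m) (hε m)
    refine ⟨min δ 1, lt_min hδ one_pos, min_le_right _ _, fun u hu v hv e1 e2 => ?_⟩
    have := H u hu v hv e1 (e2.trans (min_le_left _ _))
    rwa [abs_of_nonneg (norm_nonneg _)] at this
  choose δ hδ hδ1 H using H'
  have hη : ∀ m, 0 < ε m * δ m ^ l := fun m => mul_pos (hε m) (pow_pos (hδ m) _)
  have hηε : ∀ m, ε m * δ m ^ l ≤ ε m := fun m =>
    mul_le_of_le_one_right (hε m).le (pow_le_one₀ (hδ m).le (hδ1 m))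
  choose M₁ hM₁ t₁ ht₁ ht₁' using fun m => grid k b.1 hr (hη m) ((hηε m).trans (hε1 m))
  choose M₂ hM₂ t₂ ht₂ ht₂' using fun m => grid d b.2 hr (hδ m) (hδ1 m)
  set s : ℝ := (k : ℝ) + (p : ℝ) / l with hs
  have hs0 : 0 ≤ s := by positivity
  set C : ℝ := (K : ℝ) + 1 with hC
  have hCpos : 0 < C := by positivity
  let t : ∀ m, ((Fin k → Fin (M₁ m)) × (Fin d → Fin (M₂ m))) → Set (EuclideanSpace ℝ (Fin n)) :=
    fun m i => h '' ((B ∩ Metric.closedBall b r) ∩ (t₁ m i.1 ×ˢ t₂ m i.2))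
  have hdiam : ∀ m i, Metric.ediam (t m i) ≤ ENNReal.ofReal (C * (ε m * δ m ^ l)) := by
    intro m i
    apply Metric.ediam_le
    rintro _ ⟨u, ⟨⟨huB, hub⟩, hu1, hu2⟩, rfl⟩ _ ⟨v, ⟨⟨hvB, hvb⟩, hv1, hv2⟩, rfl⟩
    rw [edist_dist]
    apply ENNReal.ofReal_le_ofReal
    -- intermediate point
    have hw : (u.1, v.2) ∈ Metric.closedBall b r := by
      rw [Metric.mem_closedBall, Prod.dist_eq] at hub hvb ⊢
      exact max_le ((le_max_left _ _).trans hub) ((le_max_right _ _).trans hvb)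
    have a1 := H m u ⟨huB, (hball hub).2⟩ (u.1, v.2) (hball hw).2 rfl (ht₂' m _ _ hu2 _ hv2)
    have a1' : ‖h (u.1, v.2) - h u‖ ≤ ε m * δ m ^ l := by
      refine a1.trans ?_
      have := ht₂' m _ _ hu2 _ hv2
      have := (hε m).le
      gcongr
    have a2 := hK.dist_le_mul _ (hball hw).1 _ (hball hvb).1
    have a3 : dist ((u.1, v.2) : V k × V d) v ≤ ε m * δ m ^ l := by
      rw [Prod.dist_eq, dist_self, max_eq_left dist_nonneg, dist_eq_norm]
      exact ht₁' m _ _ hu1 _ hv1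
    calc dist (h u) (h v) ≤ dist (h u) (h (u.1, v.2)) + dist (h (u.1, v.2)) (h v) :=
          dist_triangle _ _ _
      _ ≤ ε m * δ m ^ l + K * (ε m * δ m ^ l) := by
        gcongr
        · rw [dist_comm, dist_eq_norm]; exact a1'
        · exact a2.trans (by gcongr)
      _ = C * (ε m * δ m ^ l) := by rw [hC]; ring
  have hcover : ∀ m, h '' (B ∩ Metric.closedBall b r) ⊆ ⋃ i, t m i := by
    rintro m _ ⟨u, hu, rfl⟩
    have hub := hu.2
    rw [Metric.mem_closedBall, Prod.dist_eq] at hub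
    obtain ⟨i, hi⟩ := mem_iUnion.1 (ht₁ m (Metric.mem_closedBall.2 ((le_max_left _ _).trans hub)))
    obtain ⟨j, hj⟩ := mem_iUnion.1 (ht₂ m (Metric.mem_closedBall.2 ((le_max_right _ _).trans hub)))
    exact mem_iUnion.2 ⟨(i, j), u, ⟨hu, hi, hj⟩, rfl⟩
  have hr0 : Tendsto (fun m => ENNReal.ofReal (C * (ε m * δ m ^ l))) atTop (𝓝 0) := by
    rw [← ENNReal.ofReal_zero]
    apply ENNReal.tendsto_ofReal
    refine squeeze_zero (fun m => (mul_pos hCpos (hη m)).le)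
      (fun m => mul_le_mul_of_nonneg_left (hηε m) hCpos.le) ?_
    simpa using hεlim.const_mul C
  have hmain := Measure.hausdorffMeasure_le_liminf_sum s (h '' (B ∩ Metric.closedBall b r))
    _ hr0 t (Eventually.of_forall hdiam) (Eventually.of_forall hcover)
  set D : ℝ := (2 * r + 1) ^ k * (2 * r + 1) ^ d * C ^ s with hD
  have hsum : ∀ m, ∑ i, Metric.ediam (t m i) ^ s ≤
      ENNReal.ofReal (D * ε m ^ ((p : ℝ) / l)) := by
    intro m
    calc ∑ i, Metric.ediam (t m i) ^ s
        ≤ ∑ i : ((Fin k → Fin (M₁ m)) × (Fin d → Fin (M₂ m))),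
          ENNReal.ofReal ((C * (ε m * δ m ^ l)) ^ s) := by
            refine Finset.sum_le_sum fun i _ => ?_
            rw [← ENNReal.ofReal_rpow_of_nonneg (mul_pos hCpos (hη m)).le hs0]
            exact ENNReal.rpow_le_rpow (hdiam m i) hs0
      _ = ENNReal.ofReal ((M₁ m : ℝ) ^ k * (M₂ m : ℝ) ^ d * (C * (ε m * δ m ^ l)) ^ s) := by
        rw [Finset.sum_const, nsmul_eq_mul, ENNReal.ofReal_mul (by positivity)]
        congr 1
        simp only [Finset.card_univ, Fintype.card_prod, Fintype.card_fun, Fintype.card_fin]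
        rw [← ENNReal.ofReal_natCast]
        push_cast
        rfl
      _ ≤ _ := by
        apply ENNReal.ofReal_le_ofReal
        exact count_bound hl hd (by positivity) hCpos (hε m) (hδ m) (hδ1 m) (by positivity)
          (by positivity) (hM₁ m) (hM₂ m)
  have hlim : Tendsto (fun m => ENNReal.ofReal (D * ε m ^ ((p : ℝ) / l))) atTop (𝓝 0) := by
    rw [← ENNReal.ofReal_zero]
    apply ENNReal.tendsto_ofReal
    have hpl : 0 < (p : ℝ) / l := by
      have : (0 : ℝ) < p := by exact_mod_cast hp
      have : (0 : ℝ) < l := by exact_mod_cast hl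
      positivity
    have h1 := hεlim.rpow_const (p := (p : ℝ) / l) (Or.inr hpl.le)
    rw [Real.zero_rpow hpl.ne'] at h1
    simpa using h1.const_mul D
  refine le_antisymm (hmain.trans ?_) zero_le
  exact (liminf_le_liminf (Eventually.of_forall hsum)).trans hlim.liminf_eq.le

theorem null_image {k p l n : ℕ} (hl : 1 ≤ l) (hp : 1 ≤ p)
    {H : V k × V p → EuclideanSpace ℝ (Fin n)} {A : Set (V k × V p)}
    (hH : ∀ a ∈ A, ContDiffAt ℝ l H a)
    (hH' : ∀ a ∈ A, ∀ y : V p, fderiv ℝ H a (0, y) = 0) :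
    μH[(k : ℝ) + (p : ℝ) / l] (H '' A) = 0 := by
  obtain ⟨m, rfl⟩ : ∃ m, l = m + 1 := ⟨l - 1, by omega⟩
  set s : ℝ := (k : ℝ) + (p : ℝ) / (m + 1 : ℕ) with hs
  change (μH[s] : Measure (EuclideanSpace ℝ (Fin n))).toOuterMeasure (H '' A) = 0
  rw [← OuterMeasure.comap_apply]
  apply morse m
  rintro S ⟨d, hd, B, ψ, hB, hLO, rfl⟩
  rw [OuterMeasure.comap_apply, image_image, ← OuterMeasure.comap_apply]
  apply measure_null_of_locally_null
  intro b hb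
  have hHb := hH _ (hB b hb).2
  have hHb1 : ContDiffAt ℝ 1 H (b.1, ψ b) := hHb.of_le (by simp)
  have hh1 : ContDiffAt ℝ 1 (fun v : V k × V d => H (v.1, ψ v)) b :=
    ContDiffAt.comp b hHb1 (contDiffAt_fst.prodMk (hB b hb).1)
  obtain ⟨K, N, hN, hK⟩ := hh1.exists_lipschitzOnWith
  have hcoord : ∀ j : Fin n, LO (m + 1) B b (fun u v => H (v.1, ψ v) j - H (u.1, ψ u) j) := by
    intro j
    have hc : ∀ a ∈ A, ContDiffAt ℝ (m + 1 : ℕ) (fun a => H a j) a := fun a ha =>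
      (EuclideanSpace.proj (𝕜 := ℝ) j).contDiff.contDiffAt.comp a (hH a ha)
    refine LO.mean_value (f := fun a => H a j) (hB b hb).1
      ((hc _ (hB b hb).2).of_le (by simp)) fun i => ?_
    refine hLO (fun a => fderiv ℝ (fun a => H a j) a (0, Pi.single i 1)) ?_ b hb
    intro a ha
    constructor
    · exact ((hc a ha).fderiv_right (m := m) (by simp)).clm_apply contDiffAt_const
    · have hd : DifferentiableAt ℝ H a := (hH a ha).differentiableAt (by simp)
      have h1 : HasFDerivAt (fun a => H a j)
          ((EuclideanSpace.proj (𝕜 := ℝ) j : EuclideanSpace ℝ (Fin n) →L[ℝ] ℝ) ∘L fderiv ℝ H a) a :=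
        (EuclideanSpace.proj (𝕜 := ℝ) j).hasFDerivAt.comp a hd.hasFDerivAt
      simp only
      rw [h1.fderiv, ContinuousLinearMap.comp_apply, hH' a ha, map_zero]
  have hLO' : LO (m + 1) B b (fun u v => ‖H (v.1, ψ v) - H (u.1, ψ u)‖) := by
    refine (LO.sum Finset.univ (fun j _ => hcoord j)).mono fun u _ v => ?_
    rw [abs_of_nonneg (norm_nonneg _), abs_of_nonneg (Finset.sum_nonneg fun _ _ => abs_nonneg _)]
    set x := H (v.1, ψ v) - H (u.1, ψ u) with hx
    have h1 := (EuclideanSpace.basisFun (Fin n) ℝ).sum_repr x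
    calc ‖x‖ = ‖∑ i, (EuclideanSpace.basisFun (Fin n) ℝ).repr x i •
          (EuclideanSpace.basisFun (Fin n) ℝ) i‖ := by rw [h1]
      _ ≤ ∑ i, ‖(EuclideanSpace.basisFun (Fin n) ℝ).repr x i •
          (EuclideanSpace.basisFun (Fin n) ℝ) i‖ := norm_sum_le _ _
      _ ≤ _ := by
        refine Finset.sum_le_sum fun i _ => ?_
        rw [norm_smul]
        simp [hx]
  obtain ⟨u, hu, hnull⟩ := box (by omega) hd hp hN hK hLO'
  refine ⟨B ∩ u, inter_mem self_mem_nhdsWithin (mem_nhdsWithin_of_mem_nhds hu), ?_⟩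
  rw [OuterMeasure.comap_apply]
  exact hnull

theorem rank_eq {n l : ℕ} (hl : 1 ≤ l)
    {F : EuclideanSpace ℝ (Fin n) → EuclideanSpace ℝ (Fin n)}
    (hF : ContDiff ℝ l F) {j : ℕ} (hj : j < n) :
    μH[(j : ℝ) + ((n - j : ℕ) : ℝ) / l]
      (F '' {x | Module.finrank ℝ (LinearMap.range
        ((fderiv ℝ F x) : EuclideanSpace ℝ (Fin n) →ₗ[ℝ] EuclideanSpace ℝ (Fin n))) = j}) = 0 := by
  set s : ℝ := (j : ℝ) + ((n - j : ℕ) : ℝ) / l with hs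
  set R := {x | Module.finrank ℝ (LinearMap.range
        ((fderiv ℝ F x) : EuclideanSpace ℝ (Fin n) →ₗ[ℝ] EuclideanSpace ℝ (Fin n))) = j} with hR
  change (μH[s] : Measure (EuclideanSpace ℝ (Fin n))).toOuterMeasure (F '' R) = 0
  rw [← OuterMeasure.comap_apply]
  apply measure_null_of_locally_null
  intro x₀ hx₀
  have hl0 : (l : WithTop ℕ∞) ≠ 0 := by exact_mod_cast (by omega : l ≠ 0)
  have hFd : Differentiable ℝ F := hF.differentiable hl0
  let L : EuclideanSpace ℝ (Fin n) →ₗ[ℝ] EuclideanSpace ℝ (Fin n) :=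
    (fderiv ℝ F x₀).toLinearMap
  have hrank : Module.finrank ℝ (LinearMap.range L) = j := hx₀
  have hker : Module.finrank ℝ (LinearMap.ker L) = n - j := by
    have := LinearMap.finrank_range_add_finrank_ker L
    rw [finrank_euclideanSpace_fin, hrank] at this
    omega
  obtain ⟨q₀, hq₀⟩ := LinearMap.exists_leftInverse_of_injective (LinearMap.range L).subtype
    (Submodule.ker_subtype _)
  obtain ⟨π₀, hπ₀⟩ := LinearMap.exists_leftInverse_of_injective (LinearMap.ker L).subtype
    (Submodule.ker_subtype _)
  have eq : LinearMap.range L ≃ₗ[ℝ] V j := LinearEquiv.ofFinrankEq _ _ (by simp [hrank])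
  have eπ : LinearMap.ker L ≃ₗ[ℝ] V (n - j) := LinearEquiv.ofFinrankEq _ _ (by simp [hker])
  let q : EuclideanSpace ℝ (Fin n) →L[ℝ] V j := (eq.toLinearMap ∘ₗ q₀).toContinuousLinearMap
  let π : EuclideanSpace ℝ (Fin n) →L[ℝ] V (n - j) :=
    (eπ.toLinearMap ∘ₗ π₀).toContinuousLinearMap
  let Φ : EuclideanSpace ℝ (Fin n) → V j × V (n - j) := fun x => (q (F x), π x)
  have hΦ : ContDiff ℝ l Φ := (q.contDiff.comp hF).prodMk π.contDiff
  have hΦ' : fderiv ℝ Φ x₀ = (q ∘L fderiv ℝ F x₀).prod π :=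
    ((q.hasFDerivAt.comp x₀ (hFd x₀).hasFDerivAt).prodMk π.hasFDerivAt).fderiv
  have hinj : ∀ v, fderiv ℝ Φ x₀ v = 0 → v = 0 := by
    intro v hv
    rw [hΦ'] at hv
    simp only [ContinuousLinearMap.prod_apply, Prod.mk_eq_zero,
      ContinuousLinearMap.comp_apply] at hv
    obtain ⟨h1, h2⟩ := hv
    have h3 : L v = 0 := by
      have e1 : q₀ (L v) = 0 := eq.map_eq_zero_iff.1 h1
      have e2 := LinearMap.congr_fun hq₀ ⟨L v, LinearMap.mem_range_self L v⟩
      simp only [LinearMap.comp_apply, Submodule.subtype_apply, LinearMap.id_apply, e1] at e2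
      exact (congrArg Subtype.val e2).symm
    have e1 : π₀ v = 0 := eπ.map_eq_zero_iff.1 h2
    have e2 := LinearMap.congr_fun hπ₀ ⟨v, h3⟩
    simp only [LinearMap.comp_apply, Submodule.subtype_apply, LinearMap.id_apply, e1] at e2
    exact (congrArg Subtype.val e2).symm
  obtain ⟨Ψ, U, hU, hΨ⟩ := ift (by simp; omega) hl hΦ.contDiffAt hinj
  refine ⟨R ∩ U, inter_mem_nhdsWithin _ hU, ?_⟩
  rw [OuterMeasure.comap_apply]
  have himg : F '' (R ∩ U) = (F ∘ Ψ) '' (Φ '' (R ∩ U)) := by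
    rw [image_image]
    refine image_congr fun w hw => ?_
    rw [Function.comp_apply, (hΨ w hw.2).1]
  rw [himg]
  refine null_image hl (by omega) ?_ ?_
  · rintro _ ⟨w, hw, rfl⟩
    exact hF.contDiffAt.comp _ (hΨ w hw.2).2.1
  · rintro _ ⟨w, hw, rfl⟩ y
    obtain ⟨e1, e2, e3⟩ := hΨ w hw.2
    have hΨd : HasFDerivAt Ψ (fderiv ℝ Ψ (Φ w)) (Φ w) := (e2.differentiableAt hl0).hasFDerivAt
    have hFw : HasFDerivAt F (fderiv ℝ F w) (Ψ (Φ w)) := by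
      rw [e1]
      exact (hFd w).hasFDerivAt
    have hH : HasFDerivAt (F ∘ Ψ) (fderiv ℝ F w ∘L fderiv ℝ Ψ (Φ w)) (Φ w) := hFw.comp _ hΨd
    have hqH : HasFDerivAt (fun c => q (F (Ψ c)))
        (q ∘L (fderiv ℝ F w ∘L fderiv ℝ Ψ (Φ w))) (Φ w) := q.hasFDerivAt.comp _ hH
    have hfst : HasFDerivAt (fun c => q (F (Ψ c)))
        (ContinuousLinearMap.fst ℝ (V j) (V (n - j))) (Φ w) := by
      refine (ContinuousLinearMap.fst ℝ (V j) (V (n - j))).hasFDerivAt.congr_of_eventuallyEq ?_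
      filter_upwards [e3] with c hc
      exact congrArg Prod.fst hc
    have huniq := hqH.unique hfst
    have happ : ∀ c, q (fderiv ℝ F w (fderiv ℝ Ψ (Φ w) c)) = c.1 := fun c =>
      DFunLike.congr_fun huniq c
    rw [hH.fderiv]
    let T := LinearMap.range
      ((fderiv ℝ F w) : EuclideanSpace ℝ (Fin n) →ₗ[ℝ] EuclideanSpace ℝ (Fin n))
    let qT : T →ₗ[ℝ] V j := (q : EuclideanSpace ℝ (Fin n) →ₗ[ℝ] V j) ∘ₗ T.subtype
    have hsurj : Function.Surjective qT := fun c =>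
      ⟨⟨fderiv ℝ F w (fderiv ℝ Ψ (Φ w) (c, 0)), ⟨_, rfl⟩⟩, happ (c, 0)⟩
    have hrk : Module.finrank ℝ T = Module.finrank ℝ (V j) := by
      rw [Module.finrank_fin_fun]
      exact hw.1
    have hinjT : Function.Injective qT :=
      (LinearMap.injective_iff_surjective_of_finrank_eq_finrank hrk).2 hsurj
    have hz : qT ⟨fderiv ℝ F w (fderiv ℝ Ψ (Φ w) (0, y)), ⟨_, rfl⟩⟩ = 0 := happ (0, y)
    have := hinjT (hz.trans (map_zero qT).symm)
    exact congrArg Subtype.val this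

end FedererSard

theorem federer_sard {n l : ℕ} (hl : 1 ≤ l)
    {F : EuclideanSpace ℝ (Fin n) → EuclideanSpace ℝ (Fin n)}
    (hF : ContDiff ℝ l F) {k : ℕ} (hk : k < n) :
    μH[(k : ℝ) + ((n : ℝ) - k) / l]
      (F '' {x | Module.finrank ℝ
        (LinearMap.range ((fderiv ℝ F x) : EuclideanSpace ℝ (Fin n) →ₗ[ℝ] EuclideanSpace ℝ (Fin n))) ≤ k}) = 0 := by
  have hsub : (F '' {x | Module.finrank ℝ
        (LinearMap.range ((fderiv ℝ F x) : EuclideanSpace ℝ (Fin n) →ₗ[ℝ] EuclideanSpace ℝ (Fin n))) ≤ k}) ⊆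
      ⋃ j : Fin (k + 1), F '' {x | Module.finrank ℝ (LinearMap.range
        ((fderiv ℝ F x) : EuclideanSpace ℝ (Fin n) →ₗ[ℝ] EuclideanSpace ℝ (Fin n))) = j} := by
    rintro _ ⟨x, hx, rfl⟩
    exact Set.mem_iUnion.2 ⟨⟨_, Nat.lt_succ_of_le hx⟩, x, rfl, rfl⟩
  refine measure_mono_null hsub (measure_iUnion_null fun j => ?_)
  have hjk : (j : ℕ) ≤ k := Nat.lt_succ_iff.1 j.2
  have h := FedererSard.rank_eq hl hF (j := j) (by omega)
  refine le_antisymm ((Measure.hausdorffMeasure_mono ?_ _).trans h.le) zero_le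
  rw [Nat.cast_sub (by omega)]
  have hl' : (1 : ℝ) ≤ l := by exact_mod_cast hl
  have hjk' : ((j : ℕ) : ℝ) ≤ k := by exact_mod_cast hjk
  have h1 : ((k : ℝ) - (j : ℕ)) / l ≤ (k : ℝ) - (j : ℕ) := div_le_self (by linarith) hl'
  have h2 : ((n : ℝ) - (j : ℕ)) / l = ((n : ℝ) - k) / l + ((k : ℝ) - (j : ℕ)) / l := by
    rw [← add_div]
    congr 1
    ring
  linarith
end

section
/- There exists a nonempty bounded open convex set Ω ⊆ ℝ² such that, setting K = ℝ² \ Ω, the closure of the set {x ∈ Ω : d_K is not Fréchet differentiable at x} has positive two-dimensional Lebesgue measure. -/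
open MeasureTheory
open Filter Topology

theorem exists_data : ∃ s l g : ℝ → ℝ, (∀ x y, x < y → s x ≤ l y) ∧ (∀ x, l x ≤ s x) ∧
    (∀ x, 0 ≤ l x) ∧ (∀ x, s x ≤ 1) ∧ (∀ x y, s x * (y - x) ≤ g y - g x) ∧
    (∀ x y, l x * (y - x) ≤ g y - g x) ∧ g 0 = 0 ∧ (∀ q : ℚ, l q < s q) ∧
    (∀ x, Tendsto s (𝓝[>] x) (𝓝 (s x))) := by
  let m0 : Measure ℝ := Measure.sum (fun q : ℚ => Measure.dirac (q : ℝ))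
  have hm0 : ∀ q : ℚ, m0 {(q : ℝ)} ≠ 0 := by
    intro q h
    have h1 : Measure.dirac (q : ℝ) {(q : ℝ)} ≤ m0 {(q : ℝ)} :=
      Measure.le_sum (fun q : ℚ => Measure.dirac (q : ℝ)) q _
    rw [h] at h1
    simp at h1
  have : NeZero m0 := ⟨fun h => hm0 0 (by rw [h]; simp)⟩
  let m : Measure ℝ := m0.toFinite
  have hm : ∀ q : ℚ, m {(q : ℝ)} ≠ 0 := fun q h => hm0 q (absolutelyContinuous_toFinite m0 h)
  let F := ProbabilityTheory.cdf m
  have hmono : Monotone F := F.mono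
  have key : ∀ k x : ℝ, (∀ u, x < u → k ≤ F u) → (∀ u, u < x → F u ≤ k) → ∀ y,
      k * (y - x) ≤ (∫ u in (0:ℝ)..y, F u) - ∫ u in (0:ℝ)..x, F u := by
    intro k x h1 h2 y
    have hi : ∀ a b, IntervalIntegrable F volume a b := fun a b => hmono.intervalIntegrable
    rw [intervalIntegral.integral_interval_sub_left (hi _ _) (hi _ _)]
    rcases le_total x y with h | h
    · have := intervalIntegral.integral_mono_on_of_le_Ioo (f := fun _ => k) (g := F) (μ := volume) h
        (by simp) (hi _ _) (fun u hu => h1 u hu.1)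
      simp at this
      linarith
    · have := intervalIntegral.integral_mono_on_of_le_Ioo (g := fun _ => k) (f := F) (μ := volume) h
        (hi _ _) (by simp) (fun u hu => h2 u hu.2)
      simp at this
      rw [intervalIntegral.integral_symm]
      linarith
  have hl0 : ∀ x, 0 ≤ Function.leftLim F x := fun x =>
    (ProbabilityTheory.cdf_nonneg m (x-1)).trans (hmono.le_leftLim (by linarith))
  refine ⟨F, Function.leftLim F, fun x => ∫ u in (0:ℝ)..x, F u, fun x y h => hmono.le_leftLim h,
    fun x => hmono.leftLim_le le_rfl, hl0, fun x => ProbabilityTheory.cdf_le_one m x, ?_, ?_, by simp, ?_, ?_⟩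
  · intro x y
    exact key (F x) x (fun u hu => hmono hu.le) (fun u hu => hmono hu.le) y
  · intro x y
    exact key _ x (fun u hu => hmono.leftLim_le hu.le) (fun u hu => hmono.le_leftLim hu) y
  · intro q
    have := F.measure_singleton q
    rw [ProbabilityTheory.measure_cdf] at this
    by_contra hc
    apply hm q
    rw [this, ENNReal.ofReal_eq_zero]
    linarith
  · intro x
    exact ((F.right_continuous x).mono Set.Ioi_subset_Ici_self)

theorem lowerbound {X : Set (EuclideanSpace ℝ (Fin 2))} (Φ : (Fin 2 → ℝ) → EuclideanSpace ℝ (Fin 2))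
    (U : Set (Fin 2 → ℝ)) (hU : volume U ≠ 0)
    (h : ∀ x ∈ U, ∀ y ∈ U, dist x y ≤ dist (Φ x) (Φ y)) (hX : Φ '' U ⊆ X) : 0 < volume X := by
  rw [pos_iff_ne_zero]
  intro h0
  have h0' : volume (Φ '' U) = 0 := measure_mono_null hX h0
  have inj : Set.InjOn Φ U := by
    intro x hx y hy hxy
    have := h x hx y hy
    rw [hxy, dist_self] at this
    exact dist_le_zero.1 this
  let G := Function.invFunOn Φ U
  have hG : ∀ x ∈ U, G (Φ x) = x := fun x hx => inj.leftInvOn_invFunOn hx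
  have hL : LipschitzOnWith 1 G (Φ '' U) := by
    apply LipschitzOnWith.of_dist_le_mul
    rintro _ ⟨x, hx, rfl⟩ _ ⟨y, hy, rfl⟩
    rw [hG x hx, hG y hy]
    simpa using h x hx y hy
  have hI : G '' (Φ '' U) = U := by
    rw [Set.image_image]
    ext z
    constructor
    · rintro ⟨x, hx, rfl⟩; simpa [hG x hx] using hx
    · intro hz; exact ⟨z, hz, hG z hz⟩
  have h2 := hL.hausdorffMeasure_image_le (d := 2) (by norm_num)
  rw [hI] at h2
  have e1 : (Measure.hausdorffMeasure 2 : Measure (Fin 2 → ℝ)) = volume := by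
    have := hausdorffMeasure_pi_real (ι := Fin 2)
    simpa using this
  have hfr : ((Module.finrank ℝ (EuclideanSpace ℝ (Fin 2)) : ℕ) : ℝ) = 2 := by simp
  have inst : (Measure.hausdorffMeasure 2 : Measure (EuclideanSpace ℝ (Fin 2))).IsAddHaarMeasure := by
    rw [← hfr]; infer_instance
  have hac : (Measure.hausdorffMeasure 2 : Measure (EuclideanSpace ℝ (Fin 2))) ≪ volume :=
    Measure.absolutelyContinuous_isAddHaarMeasure _ _
  rw [e1, hac h0'] at h2
  simp at h2
  exact hU h2

section
variable {E : Type*} [NormedAddCommGroup E] [InnerProductSpace ℝ E]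

def Om (A : Set (E × ℝ)) : Set E := {y | ∃ ε > 0, ∀ a ∈ A, inner ℝ a.1 y + ε ≤ a.2}

theorem Om_open (A : Set (E × ℝ)) (hA : ∀ a ∈ A, ‖a.1‖ = 1) : IsOpen (Om A) := by
  rw [Metric.isOpen_iff]
  rintro y ⟨ε, he, h⟩
  refine ⟨ε / 2, by positivity, fun z hz => ⟨ε / 2, by positivity, fun a ha => ?_⟩⟩
  have h1 := h a ha
  have h2 := real_inner_le_norm a.1 (z - y)
  rw [inner_sub_right, hA a ha] at h2
  rw [Metric.mem_ball, dist_eq_norm] at hz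
  linarith

theorem Om_convex (A : Set (E × ℝ)) : Convex ℝ (Om A) := by
  rintro x ⟨ε, he, h⟩ y ⟨δ, hd, h'⟩ a b ha hb hab
  refine ⟨min ε δ, lt_min he hd, fun c hc => ?_⟩
  have h1 := h c hc
  have h2 := h' c hc
  rw [inner_add_right, inner_smul_right, inner_smul_right]
  have e1 := min_le_left ε δ
  have e2 := min_le_right ε δ
  have : b = 1 - a := by linarith
  subst this
  nlinarith [mul_le_mul_of_nonneg_left (h1.trans' (add_le_add_right e1 _)) ha,
    mul_le_mul_of_nonneg_left (h2.trans' (add_le_add_right e2 _)) hb]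

theorem Om_upper (A : Set (E × ℝ)) (hA : ∀ a ∈ A, ‖a.1‖ = 1) (y : E) (hy : y ∈ Om A) (a : E × ℝ)
    (ha : a ∈ A) : Metric.infDist y (Om A)ᶜ ≤ a.2 - inner ℝ a.1 y := by
  have hp : 0 ≤ a.2 - inner ℝ a.1 y := by
    obtain ⟨ε, he, h⟩ := hy
    linarith [h a ha]
  have hm : y + (a.2 - inner ℝ a.1 y) • a.1 ∈ (Om A)ᶜ := by
    rintro ⟨ε, he, h⟩
    have := h a ha
    rw [inner_add_right, inner_smul_right, real_inner_self_eq_norm_sq, hA a ha] at this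
    linarith
  have := Metric.infDist_le_dist_of_mem (x := y) hm
  simpa [norm_smul, hA a ha, abs_of_nonneg hp] using this

theorem Om_lower (A : Set (E × ℝ)) (hA : ∀ a ∈ A, ‖a.1‖ = 1) (hne : A.Nonempty) (y : E) (r : ℝ)
    (h : ∀ a ∈ A, inner ℝ a.1 y + r ≤ a.2) : r ≤ Metric.infDist y (Om A)ᶜ := by
  obtain ⟨a, ha⟩ := hne
  have hm : (a.2) • a.1 ∈ (Om A)ᶜ := by
    rintro ⟨ε, he, h⟩
    have := h a ha
    rw [inner_smul_right, real_inner_self_eq_norm_sq, hA a ha] at this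
    linarith
  rw [Metric.le_infDist ⟨_, hm⟩]
  intro z hz
  by_contra hc
  push Not at hc
  apply hz
  refine ⟨r - dist y z, by linarith, fun b hb => ?_⟩
  have h2 := real_inner_le_norm b.1 (z - y)
  rw [inner_sub_right, hA b hb] at h2
  rw [dist_comm, dist_eq_norm]
  linarith [h b hb]

theorem Om_sing (A : Set (E × ℝ)) (hA : ∀ a ∈ A, ‖a.1‖ = 1) (z : E) (r : ℝ) (hr : 0 < r)
    (h : ∀ a ∈ A, inner ℝ a.1 z + r ≤ a.2) (a b : E × ℝ) (ha : a ∈ A) (hb : b ∈ A)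
    (ha' : inner ℝ a.1 z + r = a.2) (hb' : inner ℝ b.1 z + r = b.2) (hab : a.1 ≠ b.1) :
    z ∈ {x ∈ Om A | ¬ DifferentiableAt ℝ (fun y => Metric.infDist y (Om A)ᶜ) x} := by
  have hz : z ∈ Om A := ⟨r, hr, h⟩
  refine ⟨hz, fun hd => hab ?_⟩
  have key : ∀ c ∈ A, inner ℝ c.1 z + r = c.2 →
      fderiv ℝ (fun y => Metric.infDist y (Om A)ᶜ) z = - innerSL ℝ c.1 := by
    intro c hc hc'
    have hmin : IsLocalMin (fun y => (c.2 - inner ℝ c.1 y) - Metric.infDist y (Om A)ᶜ) z := by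
      filter_upwards [(Om_open A hA).mem_nhds hz] with y hy
      have h1 := Om_upper A hA y hy c hc
      have h2 := Om_lower A hA ⟨c, hc⟩ z r h
      linarith
    have hdd : HasFDerivAt (fun y => (c.2 - inner ℝ c.1 y) - Metric.infDist y (Om A)ᶜ)
        (- innerSL ℝ c.1 - fderiv ℝ (fun y => Metric.infDist y (Om A)ᶜ) z) z := by
      exact (((innerSL ℝ c.1).hasFDerivAt (x := z)).const_sub c.2).sub hd.hasFDerivAt
    have := hmin.hasFDerivAt_eq_zero hdd
    exact (sub_eq_zero.1 this).symm
  have := (key a ha ha').symm.trans (key b hb hb')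
  rw [neg_inj] at this
  apply ext_inner_right ℝ
  intro v
  exact congrArg (fun f => f v) this
end

noncomputable def phi (r : ℝ) : ℝ := Real.sqrt (1 + r ^ 2)

noncomputable def nu (r : ℝ) : EuclideanSpace ℝ (Fin 2) := !₂[r / phi r, -1 / phi r]

noncomputable def W (a b : ℝ) : EuclideanSpace ℝ (Fin 2) :=
  !₂[(a + b) / (phi a + phi b), (a * b - 1 - phi a * phi b) / (phi a + phi b)]

theorem phi_pos (r : ℝ) : 0 < phi r := by unfold phi; positivity

theorem phi_sq (r : ℝ) : phi r ^ 2 = 1 + r ^ 2 := by unfold phi; rw [Real.sq_sqrt]; positivity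

theorem phi_cont : Continuous phi := by unfold phi; fun_prop

theorem phi_lip (a b : ℝ) : |phi a - phi b| ≤ |a - b| := by
  rw [← sq_le_sq]
  have ha := phi_sq a
  have hb := phi_sq b
  have h : 1 + a * b ≤ phi a * phi b := by
    refine le_of_abs_le (abs_le_of_sq_le_sq ?_ ?_)
    · rw [mul_pow, ha, hb]; nlinarith [sq_nonneg (a - b)]
    · exact (mul_pos (phi_pos a) (phi_pos b)).le
  nlinarith

theorem inner_two (x y : EuclideanSpace ℝ (Fin 2)) : inner ℝ x y = x 0 * y 0 + x 1 * y 1 := by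
  simp [PiLp.inner_apply, Fin.sum_univ_two]; ring

theorem nu_norm (r : ℝ) : ‖nu r‖ = 1 := by
  have h : ‖nu r‖ ^ 2 = 1 := by
    rw [← real_inner_self_eq_norm_sq, inner_two]
    simp only [nu, PiLp.toLp_apply, Matrix.cons_val_zero, Matrix.cons_val_one]
    have := phi_pos r
    have := phi_sq r
    field_simp
    linarith
  nlinarith [norm_nonneg (nu r)]

theorem W_self (a : ℝ) : W a a = nu a := by
  have := phi_pos a
  have h := phi_sq a
  ext i
  fin_cases i
  · simp [W, nu]; field_simp
  · simp [W, nu]; field_simp; nlinarith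

theorem inner_nu_W (r a b : ℝ) : inner ℝ (nu r) (W a b) =
    (r * (a + b) - a * b + 1 + phi a * phi b) / (phi r * (phi a + phi b)) := by
  have := phi_pos a
  have := phi_pos b
  have := phi_pos r
  rw [inner_two]
  simp only [nu, W, PiLp.toLp_apply, Matrix.cons_val_zero, Matrix.cons_val_one]
  field_simp
  ring

theorem inner_le (r a b : ℝ) (h : 0 ≤ (r - a) * (r - b)) : inner ℝ (nu r) (W a b) ≤ 1 := by
  have h1 := phi_pos a
  have h2 := phi_pos b
  have h3 := phi_pos r
  rw [inner_nu_W, div_le_one (by positivity)]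
  have h4 : (phi r - phi a) * (phi r - phi b) ≤ (r - a) * (r - b) := by
    rw [← abs_of_nonneg h, abs_mul]
    refine (le_abs_self _).trans ?_
    rw [abs_mul]
    exact mul_le_mul (phi_lip _ _) (phi_lip _ _) (abs_nonneg _) (abs_nonneg _)
  nlinarith [phi_sq r]

theorem inner_eq_left (a b : ℝ) : inner ℝ (nu a) (W a b) = 1 := by
  have h1 := phi_pos a
  have h2 := phi_pos b
  rw [inner_nu_W, div_eq_one_iff_eq (by positivity)]
  nlinarith [phi_sq a]

theorem inner_eq_right (a b : ℝ) : inner ℝ (nu b) (W a b) = 1 := by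
  have h1 := phi_pos a
  have h2 := phi_pos b
  rw [inner_nu_W, div_eq_one_iff_eq (by positivity)]
  nlinarith [phi_sq b]

theorem nu_inj (a b : ℝ) (h : nu a = nu b) : a = b := by
  have h1 := phi_pos a
  have h2 := phi_pos b
  have e0 := congrArg (fun v => v 0) h
  have e1 := congrArg (fun v => v 1) h
  simp [nu] at e0 e1
  rw [neg_div, neg_div, neg_inj] at e1
  field_simp at e1
  rw [e1] at e0
  field_simp at e0
  exact e0

theorem norm_le_two (x : EuclideanSpace ℝ (Fin 2)) : ‖x‖ ≤ |x 0| + |x 1| := by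
  rw [EuclideanSpace.norm_eq, Fin.sum_univ_two]
  simp only [Real.norm_eq_abs]
  apply Real.sqrt_le_iff.2
  constructor
  · positivity
  · nlinarith [abs_nonneg (x 0), abs_nonneg (x 1)]

theorem W_norm (a b : ℝ) (ha : 0 ≤ a) (ha' : a ≤ 1) (hb : 0 ≤ b) (hb' : b ≤ 1) : ‖W a b‖ ≤ 10 := by
  have hp : ∀ r, 0 ≤ r → r ≤ 1 → 1 ≤ phi r ∧ phi r ≤ 2 := by
    intro r h h'
    have := phi_pos r
    have := phi_sq r
    constructor <;> nlinarith
  obtain ⟨h1, h2⟩ := hp a ha ha'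
  obtain ⟨h3, h4⟩ := hp b hb hb'
  have h5 : 0 ≤ a * b := mul_nonneg ha hb
  have h6 : a * b ≤ 1 := by nlinarith
  have h7 : 0 ≤ phi a * phi b := by positivity
  have h8 : phi a * phi b ≤ 4 := by nlinarith
  refine (norm_le_two _).trans ?_
  simp only [W, PiLp.toLp_apply, Matrix.cons_val_zero, Matrix.cons_val_one]
  rw [abs_div, abs_div, abs_of_pos (show 0 < phi a + phi b by linarith), ← add_div,
    div_le_iff₀ (by linarith)]
  have e1 : |a + b| ≤ 2 := by rw [abs_le]; constructor <;> linarith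
  have e2 : |a * b - 1 - phi a * phi b| ≤ 6 := by rw [abs_le]; constructor <;> linarith
  linarith

noncomputable def PP (g : ℝ → ℝ) (x : ℝ) : EuclideanSpace ℝ (Fin 2) := !₂[x, g x]

theorem inner_nu_PP (g : ℝ → ℝ) (r x : ℝ) : inner ℝ (nu r) (PP g x) = (r * x - g x) / phi r := by
  rw [inner_two]
  simp only [nu, PP, PiLp.toLp_apply, Matrix.cons_val_zero, Matrix.cons_val_one]
  ring

theorem inner_nu_PP_le (g : ℝ → ℝ) (r x y : ℝ) (h : r * (y - x) ≤ g y - g x) :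
    inner ℝ (nu r) (PP g y) ≤ inner ℝ (nu r) (PP g x) := by
  rw [inner_nu_PP, inner_nu_PP]
  apply div_le_div_of_nonneg_right _ (phi_pos r).le
  linarith

def AA (s l g : ℝ → ℝ) : Set (EuclideanSpace ℝ (Fin 2) × ℝ) :=
  {a | (∃ x r, (r = s x ∨ r = l x) ∧ a = (nu r, 1 + inner ℝ (nu r) (PP g x))) ∨
    (‖a.1‖ = 1 ∧ a.2 = 20)}

theorem counterexample_closure_singular_set_positive_measure :
    ∃ Ω : Set (EuclideanSpace ℝ (Fin 2)), Ω.Nonempty ∧ Bornology.IsBounded Ω ∧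
      IsOpen Ω ∧ Convex ℝ Ω ∧
      0 < volume
        (closure {x ∈ Ω | ¬ DifferentiableAt ℝ (fun y => Metric.infDist y Ωᶜ) x}) := by
  obtain ⟨s, l, g, hsl, hls, hl0, hs1, hgs, hgl, hg0, hq, hlim⟩ := exists_data
  have hs0 : ∀ x, 0 ≤ s x := fun x => (hl0 x).trans (hls x)
  have hl1 : ∀ x, l x ≤ 1 := fun x => (hls x).trans (hs1 x)
  have hA : ∀ a ∈ AA s l g, ‖a.1‖ = 1 := by
    rintro a (⟨x, r, -, rfl⟩ | ⟨h, -⟩)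
    · exact nu_norm r
    · exact h
  have hsub : ∀ x r, (r = s x ∨ r = l x) → ∀ y,
      inner ℝ (nu r) (PP g y) ≤ inner ℝ (nu r) (PP g x) := by
    rintro x r hr y
    apply inner_nu_PP_le
    rcases hr with rfl | rfl
    · exact hgs x y
    · exact hgl x y
  have hP0 : PP g 0 = 0 := by
    ext i; fin_cases i <;> simp [PP, hg0]
  have hPn : ∀ x, 0 ≤ x → x ≤ 2 → ‖PP g x‖ ≤ 4 := by
    intro x h0 h2
    refine (norm_le_two _).trans ?_
    simp only [PP, PiLp.toLp_apply, Matrix.cons_val_zero, Matrix.cons_val_one]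
    have h3 := hgs 0 x
    have h4 := hgs x 0
    have h5 : 0 ≤ s 0 * (x - 0) := mul_nonneg (hs0 0) (by linarith)
    have h6 : s x * x ≤ 1 * x := mul_le_mul_of_nonneg_right (hs1 x) h0
    rw [abs_of_nonneg h0, abs_of_nonneg (by linarith)]
    linarith
  have hgc : Continuous g := by
    have : LipschitzWith 1 g := by
      apply LipschitzWith.of_le_add
      intro x y
      have h1 := hgs x y
      have h2 : s x * (x - y) ≤ |x - y| := by
        refine (le_abs_self _).trans ?_
        rw [abs_mul, abs_of_nonneg (hs0 x)]
        exact mul_le_of_le_one_left (abs_nonneg _) (hs1 x)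
      rw [Real.dist_eq]
      linarith
    exact this.continuous
  have hzero : (0 : EuclideanSpace ℝ (Fin 2)) ∈ Om (AA s l g) := by
    refine ⟨1, one_pos, ?_⟩
    rintro a (⟨x, r, hr, rfl⟩ | ⟨h, h'⟩)
    · have := hsub x r hr 0
      rw [hP0] at this
      simp only [inner_zero_right] at this ⊢
      linarith
    · rw [h']; simp
  have hsing : ∀ (q : ℚ) (t : ℝ), 0 ≤ (q : ℝ) → (q : ℝ) ≤ 2 → 0 < t → t < 1 →
      PP g q + t • W (s q) (l q) ∈ {x ∈ Om (AA s l g) |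
        ¬ DifferentiableAt ℝ (fun y => Metric.infDist y (Om (AA s l g))ᶜ) x} := by
    intro q t h0 h2 ht ht'
    refine Om_sing (AA s l g) hA _ (1 - t) (by linarith) ?_
      (nu (s q), 1 + inner ℝ (nu (s q)) (PP g q)) (nu (l q), 1 + inner ℝ (nu (l q)) (PP g q))
      (Or.inl ⟨q, s q, Or.inl rfl, rfl⟩) (Or.inl ⟨q, l q, Or.inr rfl, rfl⟩) ?_ ?_ ?_
    · rintro a (⟨x, r, hr, rfl⟩ | ⟨h, h'⟩)
      · have h3 := hsub x r hr q
        have h4 : inner ℝ (nu r) (W (s q) (l q)) ≤ 1 := by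
          apply inner_le
          have : r ≤ l q ∨ s q ≤ r := by
            rcases lt_trichotomy x q with h | h | h
            · left
              have := hsl _ _ h
              have := hls x
              rcases hr with rfl | rfl <;> linarith
            · rcases hr with rfl | rfl
              · right; rw [h]
              · left; rw [h]
            · right
              have := hsl _ _ h
              have := hls x
              rcases hr with rfl | rfl <;> linarith
          have h5 := hls q
          rcases this with h | h
          · exact mul_nonneg_of_nonpos_of_nonpos (by linarith) (by linarith)
          · exact mul_nonneg (by linarith) (by linarith)
        simp only [inner_add_right, inner_smul_right]
        nlinarith
      · rw [h']
        have h3 := real_inner_le_norm a.1 (PP g q + t • W (s q) (l q))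
        have h4 := norm_add_le (PP g q) (t • W (s q) (l q))
        have h5 := hPn q h0 h2
        have h6 := W_norm (s q) (l q) (hs0 _) (hs1 _) (hl0 _) (hl1 _)
        rw [norm_smul, Real.norm_eq_abs, abs_of_pos ht] at h4
        rw [h] at h3
        nlinarith [norm_nonneg (W (s q) (l q))]
    · simp only [inner_add_right, inner_smul_right, inner_eq_left]; ring
    · simp only [inner_add_right, inner_smul_right, inner_eq_right]; ring
    · intro h
      exact (hq q).ne' (nu_inj _ _ h)
  refine ⟨Om (AA s l g), ⟨0, hzero⟩, ?_, Om_open _ hA, Om_convex _, ?_⟩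
  · refine (Metric.isBounded_closedBall (x := (0 : EuclideanSpace ℝ (Fin 2))) (r := 20)).subset ?_
    rintro y ⟨ε, he, h⟩
    rw [mem_closedBall_zero_iff]
    by_cases hy : y = 0
    · rw [hy]; simp
    have hn : ‖y‖ ≠ 0 := norm_ne_zero_iff.2 hy
    have := h (‖y‖⁻¹ • y, 20) (Or.inr ⟨by simp [norm_smul, hn], rfl⟩)
    simp only [real_inner_smul_left, real_inner_self_eq_norm_sq] at this
    have e : ‖y‖⁻¹ * ‖y‖ ^ 2 = ‖y‖ := by field_simp
    linarith
  · have hU : volume (Set.pi Set.univ (fun _ : Fin 2 => Set.Ioo (0 : ℝ) 1)) ≠ 0 := by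
      rw [volume_pi_pi]; simp
    refine lowerbound (fun v => PP g (v 0) + v 1 • nu (s (v 0))) _ hU ?_ ?_
    · intro x hx y hy
      have hx1 := (hx 1 trivial).1
      have hy1 := (hy 1 trivial).1
      have key : ∀ a b t u : ℝ, 0 < t → 0 < u →
          t - u ≤ ‖(PP g a + t • nu (s a)) - (PP g b + u • nu (s b))‖ := by
        intro a b t u ht hu
        have h1 := real_inner_le_norm (nu (s a)) ((PP g a + t • nu (s a)) - (PP g b + u • nu (s b)))
        have h2 := hsub a (s a) (Or.inl rfl) b
        have h3 := real_inner_le_norm (nu (s a)) (nu (s b))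
        simp only [inner_sub_right, inner_add_right, inner_smul_right, real_inner_self_eq_norm_sq,
          nu_norm] at h1 h3
        nlinarith
      rw [dist_pi_le_iff dist_nonneg, Fin.forall_fin_two]
      simp only [dist_eq_norm (PP g _ + _)]
      constructor
      · have h1 := real_inner_le_norm (PP g (x 0) - PP g (y 0))
          ((PP g (x 0) + x 1 • nu (s (x 0))) - (PP g (y 0) + y 1 • nu (s (y 0))))
        have h2 := hsub (x 0) _ (Or.inl rfl) (y 0)
        have h3 := hsub (y 0) _ (Or.inl rfl) (x 0)
        have h4 : (PP g (x 0) + x 1 • nu (s (x 0))) - (PP g (y 0) + y 1 • nu (s (y 0))) =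
          (PP g (x 0) - PP g (y 0)) + (x 1 • nu (s (x 0)) - y 1 • nu (s (y 0))) := by abel
        have h5 : ‖PP g (x 0) - PP g (y 0)‖ ^ 2 ≤ inner ℝ (PP g (x 0) - PP g (y 0))
          ((PP g (x 0) + x 1 • nu (s (x 0))) - (PP g (y 0) + y 1 • nu (s (y 0)))) := by
          rw [h4, inner_add_right, real_inner_self_eq_norm_sq]
          simp only [inner_sub_right, inner_sub_left, inner_smul_right]
          rw [real_inner_comm (nu (s (x 0))) (PP g (x 0)), real_inner_comm (nu (s (x 0))) (PP g (y 0)),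
            real_inner_comm (nu (s (y 0))) (PP g (x 0)), real_inner_comm (nu (s (y 0))) (PP g (y 0))]
          nlinarith
        have h6 := PiLp.norm_apply_le (PP g (x 0) - PP g (y 0)) 0
        have h7 : (PP g (x 0) - PP g (y 0)) 0 = x 0 - y 0 := by simp [PP]
        rw [h7] at h6
        rw [dist_eq_norm]
        refine h6.trans ?_
        by_contra hc
        push Not at hc
        have h8 := norm_nonneg ((PP g (x 0) + x 1 • nu (s (x 0))) - (PP g (y 0) + y 1 • nu (s (y 0))))
        nlinarith
      · rw [Real.dist_eq, abs_le]
        have h1 := key (x 0) (y 0) (x 1) (y 1) hx1 hy1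
        have h2 := key (y 0) (x 0) (y 1) (x 1) hy1 hx1
        rw [norm_sub_rev] at h2
        constructor <;> linarith
    · rintro _ ⟨v, hv, rfl⟩
      have hv0 := hv 0 trivial
      have hv1 := hv 1 trivial
      have hl : Tendsto l (𝓝[>] (v 0)) (𝓝 (s (v 0))) := by
        refine tendsto_of_tendsto_of_tendsto_of_le_of_le' tendsto_const_nhds (hlim (v 0)) ?_ ?_
        · filter_upwards [self_mem_nhdsWithin] with y hy using hsl _ _ hy
        · exact Eventually.of_forall hls
      have hWc : Continuous (fun p : ℝ × ℝ => W p.1 p.2) := by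
        have h1 := phi_cont
        have : ∀ p : ℝ × ℝ, phi p.1 + phi p.2 ≠ 0 := fun p =>
          (add_pos (phi_pos _) (phi_pos _)).ne'
        refine (PiLp.continuous_toLp 2 _).comp (continuous_pi fun i => ?_)
        fin_cases i
        · simp; fun_prop (disch := assumption)
        · simp; fun_prop (disch := assumption)
      have hPc : Continuous (PP g) := by
        refine (PiLp.continuous_toLp 2 _).comp (continuous_pi fun i => ?_)
        fin_cases i
        · simp; fun_prop
        · simp; fun_prop
      have hT : Tendsto (fun y => PP g y + v 1 • W (s y) (l y)) (𝓝[>] (v 0))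
          (𝓝 (PP g (v 0) + v 1 • nu (s (v 0)))) := by
        rw [← W_self]
        refine ((hPc.tendsto _).mono_left nhdsWithin_le_nhds).add (Tendsto.const_smul ?_ _)
        exact (hWc.tendsto (s (v 0), s (v 0))).comp ((hlim (v 0)).prodMk_nhds hl)
      refine mem_closure_of_frequently_of_tendsto ?_ hT
      rw [frequently_nhdsWithin_iff]
      rw [(nhds_basis_Ioo_pos (v 0)).frequently_iff]
      intro ε he
      obtain ⟨q, h1, h2⟩ := exists_rat_btwn (show v 0 < min (v 0 + ε) 2 from
        lt_min (by linarith) (by linarith [hv0.2]))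
      rw [lt_min_iff] at h2
      exact ⟨q, ⟨by linarith, h2.1⟩, hsing q (v 1) (by linarith [hv0.1]) h2.2.le hv1.1 hv1.2, h1⟩
end
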